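/- arXiv:2509.22629 — 2 statements merged into one kernel-verified Lean document; each statement's English description precedes it below -/
import Mathlib

section
/- Let s ∈ ℕ and R, p, β > 0, and let 𝒢 be an s-uniform hypergraph on a finite vertex set. If 𝒢[W] is (p,R)-Janson for every W ⊆ V(𝒢) with |W| ≥ (1−β)·v(𝒢), then there exists a measure μ : 𝒢 → ℝ≥0 with e(μ) = √R, Λ_p(μ) < e(μ)²/R, and Σ_{v ∈ V(𝒢)} d_μ(v)² ≤ 2s²e(μ)²/(β·v(𝒢)). -/
open scoped Classical

noncomputable section

/-- Total mass `e(ν)` of a measure `ν` on the hypergraph `G`. -/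
def eMass {V : Type*} (G : Finset (Finset V)) (ν : Finset V → ℝ) : ℝ := ∑ E ∈ G, ν E

/-- Degree `d_ν(L)` of a set `L` in the measure `ν`. -/
def dMass {V : Type*} (G : Finset (Finset V)) (ν : Finset V → ℝ) (L : Finset V) : ℝ :=
  ∑ E ∈ G.filter (fun E => L ⊆ E), ν E

/-- `Λ_p(ν) = Σ_{L ⊆ V, |L| ≥ 2} d_ν(L)² p^{−|L|}`. -/
def lamP {V : Type*} [Fintype V] (p : ℝ) (G : Finset (Finset V)) (ν : Finset V → ℝ) : ℝ :=
  ∑ L ∈ (Finset.univ : Finset (Finset V)).filter (fun L => 2 ≤ L.card),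
    dMass G ν L ^ 2 / p ^ L.card

/-- `ν` is a (nonnegative) measure supported on the edges of `G`. -/
def IsMeasureOn {V : Type*} (G : Finset (Finset V)) (ν : Finset V → ℝ) : Prop :=
  (∀ E, 0 ≤ ν E) ∧ ∀ E, E ∉ G → ν E = 0

/-- The induced subhypergraph `G[X]`. -/
def indHG {V : Type*} (G : Finset (Finset V)) (X : Finset V) : Finset (Finset V) :=
  G.filter (fun E => E ⊆ X)

/-- `G` is `(p,R)`-Janson: for `R > 0` there is a measure `ν` on `G` with
`Λ_p(ν) < e(ν)²/R`; for `R = 0` every hypergraph is `(p,R)`-Janson. -/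
def IsJanson {V : Type*} [Fintype V] (p R : ℝ) (G : Finset (Finset V)) : Prop :=
  0 < R → ∃ ν : Finset V → ℝ, IsMeasureOn G ν ∧ lamP p G ν < eMass G ν ^ 2 / R

/-- `I` is an independent set of the hypergraph `G`: no edge of `G` is a subset of `I`. -/
def IndepIn {V : Type*} (G : Finset (Finset V)) (I : Finset V) : Prop := ∀ E ∈ G, ¬ E ⊆ I

section JansonAux

variable {V : Type*}

lemma eMass_lin (G : Finset (Finset V)) (a b : ℝ) (x y : Finset V → ℝ) :
    eMass G (a • x + b • y) = a * eMass G x + b * eMass G y := by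
  simp [eMass, Finset.sum_add_distrib, Finset.mul_sum]

lemma dMass_lin (G : Finset (Finset V)) (a b : ℝ) (x y : Finset V → ℝ) (L : Finset V) :
    dMass G (a • x + b • y) L = a * dMass G x L + b * dMass G y L := by
  simp [dMass, Finset.sum_add_distrib, Finset.mul_sum]

lemma eMass_smul (G : Finset (Finset V)) (a : ℝ) (x : Finset V → ℝ) :
    eMass G (a • x) = a * eMass G x := by
  simp [eMass, Finset.mul_sum]

lemma dMass_smul (G : Finset (Finset V)) (a : ℝ) (x : Finset V → ℝ) (L : Finset V) :
    dMass G (a • x) L = a * dMass G x L := by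
  simp [dMass, Finset.mul_sum]

lemma lamP_smul [Fintype V] (p : ℝ) (G : Finset (Finset V)) (a : ℝ) (x : Finset V → ℝ) :
    lamP p G (a • x) = a ^ 2 * lamP p G x := by
  simp only [lamP, dMass_smul, Finset.mul_sum]
  exact Finset.sum_congr rfl fun L _ => by ring

lemma dMass_nonneg {G : Finset (Finset V)} {ν : Finset V → ℝ} (hν : IsMeasureOn G ν)
    (L : Finset V) : 0 ≤ dMass G ν L :=
  Finset.sum_nonneg fun E _ => hν.1 E

lemma IsMeasureOn.smul {G : Finset (Finset V)} {ν : Finset V → ℝ} (hν : IsMeasureOn G ν)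
    {a : ℝ} (ha : 0 ≤ a) : IsMeasureOn G (a • ν) :=
  ⟨fun E => mul_nonneg ha (hν.1 E), fun E hE => by simp [hν.2 E hE]⟩

lemma IsMeasureOn.mono {G H : Finset (Finset V)} (hHG : H ⊆ G) {ν : Finset V → ℝ}
    (hν : IsMeasureOn H ν) : IsMeasureOn G ν :=
  ⟨hν.1, fun E hE => hν.2 E fun h => hE (hHG h)⟩

lemma IsMeasureOn.eMass_eq {G H : Finset (Finset V)} (hHG : H ⊆ G) {ν : Finset V → ℝ}
    (hν : IsMeasureOn H ν) : eMass G ν = eMass H ν :=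
  (Finset.sum_subset hHG fun E _ hE => hν.2 E hE).symm

lemma IsMeasureOn.dMass_eq {G H : Finset (Finset V)} (hHG : H ⊆ G) {ν : Finset V → ℝ}
    (hν : IsMeasureOn H ν) (L : Finset V) : dMass G ν L = dMass H ν L := by
  refine (Finset.sum_subset (Finset.filter_subset_filter _ hHG) fun E hE hE' =>
    hν.2 E fun h => ?_).symm
  exact hE' (Finset.mem_filter.2 ⟨h, (Finset.mem_filter.1 hE).2⟩)

lemma IsMeasureOn.lamP_eq [Fintype V] {G H : Finset (Finset V)} (hHG : H ⊆ G)
    {ν : Finset V → ℝ} (hν : IsMeasureOn H ν) (p : ℝ) : lamP p G ν = lamP p H ν := by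
  simp only [lamP, hν.dMass_eq hHG]

lemma lamP_nonneg [Fintype V] {p : ℝ} (hp : 0 < p) (G : Finset (Finset V))
    (ν : Finset V → ℝ) : 0 ≤ lamP p G ν :=
  Finset.sum_nonneg fun L _ => by positivity

lemma convexOn_lamP [Fintype V] {p : ℝ} (hp : 0 < p) (G : Finset (Finset V)) :
    ConvexOn ℝ Set.univ (lamP p G) := by
  refine ⟨convex_univ, fun x _ y _ a b ha hb hab => ?_⟩
  simp only [lamP, dMass_lin, smul_eq_mul, Finset.mul_sum, ← Finset.sum_add_distrib]
  refine Finset.sum_le_sum fun L _ => ?_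
  rw [← mul_div_assoc, ← mul_div_assoc, ← add_div]
  gcongr
  obtain rfl : b = 1 - a := by linarith
  nlinarith [mul_nonneg (mul_nonneg ha hb) (sq_nonneg (dMass G x L - dMass G y L))]

/-- The probability measures on `G` with `Λ_p < c` form a convex set. -/
lemma convex_normalized_witnesses [Fintype V] {p : ℝ} (hp : 0 < p) (G : Finset (Finset V))
    (c : ℝ) :
    Convex ℝ {ν : Finset V → ℝ | IsMeasureOn G ν ∧ eMass G ν = 1 ∧ lamP p G ν < c} := by
  rintro x ⟨hx, hx1, hxc⟩ y ⟨hy, hy1, hyc⟩ a b ha hb hab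
  refine ⟨⟨fun E => ?_, fun E hE => by simp [hx.2 E hE, hy.2 E hE]⟩, ?_, ?_⟩
  · exact add_nonneg (mul_nonneg ha (hx.1 E)) (mul_nonneg hb (hy.1 E))
  · rw [eMass_lin, hx1, hy1]
    linarith
  · exact ((convexOn_lamP hp G).convex_lt c ⟨trivial, hxc⟩ ⟨trivial, hyc⟩ ha hb hab).2

/-- A Janson hypergraph has a Janson witness of total mass one. -/
lemma IsJanson.exists_eMass_eq_one [Fintype V] {p R : ℝ} (hp : 0 < p) (hR : 0 < R)
    {G : Finset (Finset V)} (h : IsJanson p R G) :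
    ∃ ν, IsMeasureOn G ν ∧ eMass G ν = 1 ∧ lamP p G ν < 1 / R := by
  obtain ⟨ν, hν, hlt⟩ := h hR
  have he0 : 0 ≤ eMass G ν := Finset.sum_nonneg fun E _ => hν.1 E
  have he : eMass G ν ≠ 0 := by
    intro h0
    rw [h0] at hlt
    simpa using (lamP_nonneg hp G ν).trans_lt hlt
  have hpos : 0 < eMass G ν := he0.lt_of_ne' he
  refine ⟨(eMass G ν)⁻¹ • ν, hν.smul (inv_nonneg.2 he0), ?_, ?_⟩
  · rw [eMass_smul, inv_mul_cancel₀ he]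
  · rw [lamP_smul]
    calc _ < (eMass G ν)⁻¹ ^ 2 * (eMass G ν ^ 2 / R) := by gcongr
      _ = 1 / R := by field_simp

lemma sum_dMass_singleton [Fintype V] {s : ℕ} {G : Finset (Finset V)}
    (hunif : ∀ E ∈ G, E.card = s) (ν : Finset V → ℝ) :
    ∑ v : V, dMass G ν {v} = s * eMass G ν := by
  simp only [dMass, eMass, Finset.sum_filter, Finset.singleton_subset_iff]
  rw [Finset.sum_comm, Finset.mul_sum]
  refine Finset.sum_congr rfl fun E hE => ?_
  simp [hunif E hE]

lemma dMass_singleton_eq_zero {G : Finset (Finset V)} {W : Finset V} {ν : Finset V → ℝ}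
    (hν : IsMeasureOn (indHG G W) ν) {v : V} (hv : v ∉ W) : dMass G ν {v} = 0 := by
  refine Finset.sum_eq_zero fun E hE => hν.2 E fun h => hv ?_
  exact (Finset.mem_filter.1 h).2 (Finset.singleton_subset_iff.1 (Finset.mem_filter.1 hE).2)

/-- First-order optimality: a minimizer `x` of `Σ_v d(v)²` on a convex set satisfies
`Σ_v d_x(v)² ≤ Σ_v d_x(v) d_y(v)` for all `y` in this set. -/
lemma sum_sq_dMass_le_of_isMinOn [Fintype V] {G : Finset (Finset V)}
    {K : Set (Finset V → ℝ)} (hK : Convex ℝ K) {x y : Finset V → ℝ} (hx : x ∈ K) (hy : y ∈ K)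
    (hmin : IsMinOn (fun ν => ∑ v : V, dMass G ν {v} ^ 2) K x) :
    ∑ v : V, dMass G x {v} ^ 2 ≤ ∑ v : V, dMass G x {v} * dMass G y {v} := by
  set A := ∑ v : V, dMass G x {v} ^ 2 with hA
  set B := ∑ v : V, dMass G x {v} * dMass G y {v} with hB
  set C := ∑ v : V, dMass G y {v} ^ 2 with hC
  have hA0 : 0 ≤ A := Finset.sum_nonneg fun v _ => sq_nonneg _
  have hC0 : 0 ≤ C := Finset.sum_nonneg fun v _ => sq_nonneg _
  have key : ∀ ε : ℝ, 0 ≤ ε → ε ≤ 1 →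
      A ≤ (1 - ε) ^ 2 * A + 2 * ε * (1 - ε) * B + ε ^ 2 * C := by
    intro ε h0 h1
    have := hmin (hK hx hy (sub_nonneg.2 h1) h0 (by ring))
    simp only [Set.mem_ofPred_eq, dMass_lin] at this
    refine this.trans_eq ?_
    rw [hA, hB, hC, Finset.mul_sum, Finset.mul_sum, Finset.mul_sum, ← Finset.sum_add_distrib,
      ← Finset.sum_add_distrib]
    exact Finset.sum_congr rfl fun v _ => by ring
  by_contra! hlt
  have hden : 0 < A + C + 2 * (A - B) := by linarith
  have := key ((A - B) / (A + C + 2 * (A - B))) (div_nonneg (by linarith) hden.le)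
    ((div_le_one hden).2 (by linarith))
  set ε := (A - B) / (A + C + 2 * (A - B))
  have hε0 : 0 < ε := div_pos (by linarith) hden
  have hεd : ε * (A + C + 2 * (A - B)) = A - B := div_mul_cancel₀ _ hden.ne'
  have h2 : 0 ≤ ε * (-2 * (A - B) + ε * (A - 2 * B + C)) := by linarith
  have h3 := nonneg_of_mul_nonneg_right h2 hε0
  linarith [mul_pos hε0 (show 0 < 3 * A + 2 * (A - B) + C by linarith)]

/-- Markov's inequality for the degrees of a probability measure. -/
lemma le_card_filter_dMass_le [Fintype V] [Nonempty V] {s : ℕ} {β : ℝ} (hβ : 0 < β)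
    {G : Finset (Finset V)} (hunif : ∀ E ∈ G, E.card = s) {ν : Finset V → ℝ}
    (hν : IsMeasureOn G ν) (h1 : eMass G ν = 1) :
    (1 - β) * (Fintype.card V : ℝ) ≤
      ((Finset.univ.filter fun v : V =>
        dMass G ν {v} ≤ s / (β * Fintype.card V)).card : ℝ) := by
  set t : ℝ := s / (β * Fintype.card V) with ht
  have hn : (0 : ℝ) < Fintype.card V := by exact_mod_cast Fintype.card_pos
  have hsum := sum_dMass_singleton hunif ν
  rw [h1, mul_one] at hsum
  have hcard := Finset.card_filter_add_card_filter_not (s := (Finset.univ : Finset V))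
    (fun v : V => dMass G ν {v} ≤ t)
  rw [Finset.card_univ] at hcard
  have hcard' : ((Finset.univ.filter fun v : V => dMass G ν {v} ≤ t).card : ℝ) +
      ((Finset.univ.filter fun v : V => ¬ dMass G ν {v} ≤ t).card : ℝ) = Fintype.card V := by
    exact_mod_cast hcard
  suffices ((Finset.univ.filter fun v : V => ¬ dMass G ν {v} ≤ t).card : ℝ) ≤
      β * Fintype.card V by linarith
  rcases Nat.eq_zero_or_pos s with rfl | hs
  · have hz : ∀ v : V, dMass G ν {v} = 0 := fun v =>
      (Finset.sum_eq_zero_iff_of_nonneg fun v _ => dMass_nonneg hν {v}).1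
        (by simpa using hsum) v (Finset.mem_univ v)
    simp only [hz, ht, Nat.cast_zero, zero_div, le_refl, not_true_eq_false,
      Finset.filter_false, Finset.card_empty]
    positivity
  · have hs' : (0 : ℝ) < s := by exact_mod_cast hs
    have htpos : 0 < t := by positivity
    have hle : ((Finset.univ.filter fun v : V => ¬ dMass G ν {v} ≤ t).card : ℝ) * t ≤ s := by
      rw [← hsum, ← nsmul_eq_mul]
      refine (Finset.card_nsmul_le_sum _ (fun v => dMass G ν {v}) t fun v hv => ?_).trans
        (Finset.sum_le_sum_of_subset_of_nonneg (Finset.filter_subset _ _)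
          fun v _ _ => dMass_nonneg hν {v})
      exact (not_le.1 (Finset.mem_filter.1 hv).2).le
    have hts : β * Fintype.card V * t = s := by
      rw [ht]
      field_simp
    exact le_of_mul_le_mul_right (hle.trans_eq hts.symm) htpos

end JansonAux

/-- **Lemma 7.5.**  Let `𝒢` be `s`-uniform and suppose `𝒢[W]` is `(p,R)`-Janson for every
`W ⊆ V(𝒢)` with `|W| ≥ (1-β)·v(𝒢)`.  Then there is a measure `μ` on `𝒢` with `e(μ) = √R`,
`Λ_p(μ) < e(μ)²/R` and `Σ_v d_μ(v)² ≤ 2s²e(μ)²/(β·v(𝒢))`. -/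
theorem bounded_degree_janson_witness {V : Type*} [Fintype V]
    (s : ℕ) (R p β : ℝ) (hR : 0 < R) (hp : 0 < p) (hβ : 0 < β)
    (G : Finset (Finset V)) (hunif : ∀ E ∈ G, E.card = s)
    (h : ∀ W : Finset V, (1 - β) * (Fintype.card V : ℝ) ≤ (W.card : ℝ) →
      IsJanson p R (indHG G W)) :
    ∃ μ : Finset V → ℝ, IsMeasureOn G μ ∧
      eMass G μ = Real.sqrt R ∧
      lamP p G μ < eMass G μ ^ 2 / R ∧
      ∑ v : V, dMass G μ {v} ^ 2 ≤
        2 * (s : ℝ) ^ 2 * eMass G μ ^ 2 / (β * (Fintype.card V : ℝ)) := by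
  have key : ∀ W : {W : Finset V // (1 - β) * (Fintype.card V : ℝ) ≤ (W.card : ℝ)},
      ∃ ν, IsMeasureOn (indHG G W) ν ∧ eMass G ν = 1 ∧ lamP p G ν < 1 / R := by
    intro W
    obtain ⟨ν, hν, h1, hlam⟩ := (h W.1 W.2).exists_eMass_eq_one hp hR
    have hsub : indHG G W ⊆ G := Finset.filter_subset _ _
    exact ⟨ν, hν, by rw [hν.eMass_eq hsub, h1], by rwa [hν.lamP_eq hsub]⟩
  choose ω hω hω1 hωlam using key
  set K := convexHull ℝ (Set.range ω)
  have hKcompact : IsCompact K := (Set.finite_range ω).isCompact_convexHull ℝ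
  have hKsub : K ⊆ {ν | IsMeasureOn G ν ∧ eMass G ν = 1 ∧ lamP p G ν < 1 / R} := by
    refine convexHull_min ?_ (convex_normalized_witnesses hp G _)
    rintro _ ⟨W, rfl⟩
    exact ⟨(hω W).mono (Finset.filter_subset _ _), hω1 W, hωlam W⟩
  have hmemK : ∀ W, ω W ∈ K := fun W => subset_convexHull ℝ _ ⟨W, rfl⟩
  have hKne : K.Nonempty := by
    refine ⟨_, hmemK ⟨Finset.univ, ?_⟩⟩
    rw [Finset.card_univ]
    nlinarith [mul_nonneg hβ.le (Nat.cast_nonneg (α := ℝ) (Fintype.card V))]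
  have hcont : Continuous fun ν : Finset V → ℝ => ∑ v : V, dMass G ν {v} ^ 2 := by
    unfold dMass
    fun_prop
  obtain ⟨ν, hνK, hmin⟩ := hKcompact.exists_isMinOn hKne hcont.continuousOn
  obtain ⟨hν, hν1, hνlam⟩ := hKsub hνK
  have hdeg : ∑ v : V, dMass G ν {v} ^ 2 ≤ 2 * (s : ℝ) ^ 2 / (β * Fintype.card V) := by
    rcases isEmpty_or_nonempty V with hV | hV
    · simp
    set W : Finset V := Finset.univ.filter fun v : V =>
      dMass G ν {v} ≤ s / (β * Fintype.card V)
    have hWcard := le_card_filter_dMass_le hβ hunif hν hν1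
    set y := ω ⟨W, hWcard⟩
    have hyW : IsMeasureOn (indHG G W) y := hω ⟨W, hWcard⟩
    obtain ⟨hyG, hy1, -⟩ := hKsub (hmemK ⟨W, hWcard⟩)
    calc ∑ v : V, dMass G ν {v} ^ 2
        ≤ ∑ v : V, dMass G ν {v} * dMass G y {v} :=
          sum_sq_dMass_le_of_isMinOn (convex_convexHull ℝ _) hνK (hmemK _) hmin
      _ ≤ ∑ v : V, s / (β * Fintype.card V) * dMass G y {v} := by
          refine Finset.sum_le_sum fun v _ => ?_
          by_cases hv : v ∈ W
          · exact mul_le_mul_of_nonneg_right (Finset.mem_filter.1 hv).2 (dMass_nonneg hyG _)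
          · simp [dMass_singleton_eq_zero hyW hv]
      _ = (s : ℝ) ^ 2 / (β * Fintype.card V) := by
          rw [← Finset.mul_sum, sum_dMass_singleton hunif, hy1]
          ring
      _ ≤ 2 * (s : ℝ) ^ 2 / (β * Fintype.card V) := by
          gcongr
          linarith [sq_nonneg (s : ℝ)]
  have he : eMass G (Real.sqrt R • ν) = Real.sqrt R := by rw [eMass_smul, hν1, mul_one]
  refine ⟨Real.sqrt R • ν, hν.smul (Real.sqrt_nonneg R), he, ?_, ?_⟩
  · rw [he, lamP_smul, Real.sq_sqrt hR.le, div_self hR.ne']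
    calc R * lamP p G ν < R * (1 / R) := by gcongr
      _ = 1 := mul_one_div_cancel hR.ne'
  · simp only [he, dMass_smul, mul_pow, Real.sq_sqrt hR.le, ← Finset.mul_sum]
    calc R * ∑ v : V, dMass G ν {v} ^ 2
        ≤ R * (2 * (s : ℝ) ^ 2 / (β * Fintype.card V)) := by gcongr
      _ = 2 * (s : ℝ) ^ 2 * R / (β * Fintype.card V) := by ring

end
end

section
/- Let p > 0, let 𝒢 be a hypergraph, U a set, and π : V(𝒢) → U a function satisfying |π(E)| = |E| for every E ∈ 𝒢. Then for every measure ϑ : π(𝒢) → ℝ≥0, one has Λ_p(ϑ∘̂π) ≤ Λ_p(ϑ), where Λ_p(ϑ) is computed in the hypergraph π(𝒢) on U and Λ_p(ϑ∘̂π) in 𝒢. -/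
open scoped Classical

noncomputable section

/-- The image hypergraph `π(𝒢) = {π(E) : E ∈ 𝒢}`. -/
def pushHG {V U : Type*} [DecidableEq U] (π : V → U) (G : Finset (Finset V)) :
    Finset (Finset U) :=
  G.image fun E => E.image π

/-- The pullback measure `ϑ∘̂π`, defined by
`(ϑ∘̂π)(E) = ϑ(π(E)) / #{E₀ ∈ 𝒢 : π(E₀) = π(E)}`. -/
def pullback {V U : Type*} [DecidableEq U] (G : Finset (Finset V)) (π : V → U)
    (θ : Finset U → ℝ) : Finset V → ℝ :=
  fun E => θ (E.image π) / ((G.filter fun E₀ => E₀.image π = E.image π).card : ℝ)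

/-- The pullback measure is nonnegative when `θ` is. -/
theorem pullback_nonneg {V U : Type*} [DecidableEq U] (G : Finset (Finset V)) (π : V → U)
    {θ : Finset U → ℝ} (hθ : ∀ F, 0 ≤ θ F) (E : Finset V) : 0 ≤ pullback G π θ E :=
  div_nonneg (hθ _) (Nat.cast_nonneg _)

/-- The pullback measure distributes the mass of each edge of `π(𝒢)` over its fibre. -/
theorem sum_fiber_pullback {V U : Type*} [DecidableEq U] (G : Finset (Finset V)) (π : V → U)
    (θ : Finset U → ℝ) {F : Finset U} (hF : F ∈ pushHG π G) :
    ∑ E ∈ G.filter (fun E => E.image π = F), pullback G π θ E = θ F := by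
  have hconst : ∀ E ∈ G.filter (fun E => E.image π = F), pullback G π θ E =
      θ F / ((G.filter fun E₀ => E₀.image π = F).card : ℝ) := by
    intro E hE
    simp only [pullback, (Finset.mem_filter.mp hE).2]
  rw [Finset.sum_congr rfl hconst, Finset.sum_const, nsmul_eq_mul]
  apply mul_div_cancel₀
  obtain ⟨E, hE, hEF⟩ := Finset.mem_image.mp hF
  exact Nat.cast_ne_zero.mpr (Finset.card_ne_zero_of_mem (Finset.mem_filter.mpr ⟨hE, hEF⟩))

/-- The degree of `K` in `θ` is the pullback mass of the edges whose image contains `K`. -/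
theorem dMass_pushHG_eq {V U : Type*} [DecidableEq U] (G : Finset (Finset V)) (π : V → U)
    (θ : Finset U → ℝ) (K : Finset U) :
    dMass (pushHG π G) θ K =
      ∑ E ∈ G.filter (fun E => K ⊆ E.image π), pullback G π θ E := by
  have hmaps : ∀ E ∈ G.filter (fun E => K ⊆ E.image π),
      E.image π ∈ (pushHG π G).filter (fun F => K ⊆ F) := by
    intro E hE
    rw [Finset.mem_filter] at hE ⊢
    exact ⟨Finset.mem_image_of_mem _ hE.1, hE.2⟩
  rw [dMass, ← Finset.sum_fiberwise_of_maps_to hmaps]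
  refine Finset.sum_congr (by ext; simp) fun F hF => ?_
  rw [Finset.mem_filter] at hF
  rw [← sum_fiber_pullback G π θ hF.1]
  refine Finset.sum_congr ?_ fun _ _ => rfl
  ext E
  simp only [Finset.mem_filter]
  constructor
  · rintro ⟨h1, h2⟩
    exact ⟨⟨h1, h2 ▸ hF.2⟩, h2⟩
  · rintro ⟨⟨h1, -⟩, h2⟩
    exact ⟨h1, h2⟩

/-- The pullback degrees of distinct sets with image `K` add up to at most the degree of `K`. -/
theorem sum_dMass_pullback_le {V U : Type*} [DecidableEq U] (G : Finset (Finset V)) (π : V → U)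
    (hπ : ∀ E ∈ G, (E.image π).card = E.card) {θ : Finset U → ℝ} (hθ : ∀ F, 0 ≤ θ F)
    (K : Finset U) (A : Finset (Finset V)) (hA : ∀ L ∈ A, L.image π = K) :
    ∑ L ∈ A, dMass G (pullback G π θ) L ≤ dMass (pushHG π G) θ K := by
  rw [dMass_pushHG_eq]
  simp only [dMass]
  rw [Finset.sum_comm' (t' := G.filter fun E => K ⊆ E.image π)
    (s' := fun E => A.filter fun L => L ⊆ E)]
  · refine Finset.sum_le_sum fun E hE => ?_
    have hinj : Set.InjOn π E := Finset.card_image_iff.mp (hπ E (Finset.mem_filter.mp hE).1)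
    have hcard : (A.filter fun L => L ⊆ E).card ≤ 1 := by
      refine Finset.card_le_one.mpr fun L hL L' hL' => ?_
      rw [Finset.mem_filter] at hL hL'
      have himage : π '' (L : Set V) = π '' (L' : Set V) := by
        rw [← Finset.coe_image, ← Finset.coe_image, hA L hL.1, hA L' hL'.1]
      exact Finset.coe_injective ((hinj.image_eq_image_iff (Finset.coe_subset.mpr hL.2)
        (Finset.coe_subset.mpr hL'.2)).mp himage)
    rw [Finset.sum_const, nsmul_eq_mul]
    exact mul_le_of_le_one_left (pullback_nonneg G π hθ E) (by exact_mod_cast hcard)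
  · intro L E
    simp only [Finset.mem_filter]
    constructor
    · rintro ⟨hL, hE, hLE⟩
      exact ⟨⟨hL, hLE⟩, hE, hA L hL ▸ Finset.image_subset_image hLE⟩
    · rintro ⟨⟨hL, hLE⟩, hE, -⟩
      exact ⟨hL, hE, hLE⟩

/-- A set on which `π` is not injective lies in no edge, so it has degree zero. -/
theorem dMass_eq_zero_of_card_image_ne {V U : Type*} [DecidableEq U] (G : Finset (Finset V))
    (π : V → U) (hπ : ∀ E ∈ G, (E.image π).card = E.card) (ν : Finset V → ℝ) {L : Finset V}
    (hL : (L.image π).card ≠ L.card) : dMass G ν L = 0 := by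
  rw [dMass, Finset.filter_false_of_mem, Finset.sum_empty]
  intro E hE hLE
  exact hL (Finset.card_image_of_injOn
    ((Finset.card_image_iff.mp (hπ E hE)).mono (Finset.coe_subset.mpr hLE)))

/-- **Lemma 7.7 (Appendix C).**  Suppose `|π(E)| = |E|` for every `E ∈ 𝒢` and `ϑ` is a
measure on `π(𝒢)`.  Then `Λ_p(ϑ∘̂π) ≤ Λ_p(ϑ)`, where `Λ_p(ϑ)` is computed in `π(𝒢)` and
`Λ_p(ϑ∘̂π)` in `𝒢`. -/
theorem lambda_pullback_le {V U : Type*} [Fintype V] [Fintype U] [DecidableEq U]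
    (p : ℝ) (hp : 0 < p)
    (G : Finset (Finset V)) (π : V → U)
    (hπ : ∀ E ∈ G, (E.image π).card = E.card)
    (θ : Finset U → ℝ) (hθ : IsMeasureOn (pushHG π G) θ) :
    lamP p G (pullback G π θ) ≤ lamP p (pushHG π G) θ := by
  have hd : ∀ L, 0 ≤ dMass G (pullback G π θ) L := fun L =>
    Finset.sum_nonneg fun E _ => pullback_nonneg G π hθ.1 E
  let S := (Finset.univ : Finset (Finset V)).filter
    fun L => 2 ≤ L.card ∧ (L.image π).card = L.card
  have hrestrict : lamP p G (pullback G π θ) =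
      ∑ L ∈ S, dMass G (pullback G π θ) L ^ 2 / p ^ L.card := by
    refine (Finset.sum_subset ?_ ?_).symm
    · intro L hL
      simp only [S, Finset.mem_filter] at hL ⊢
      exact ⟨hL.1, hL.2.1⟩
    · intro L hL hLS
      simp only [S, Finset.mem_filter, Finset.mem_univ, true_and] at hL hLS
      rw [dMass_eq_zero_of_card_image_ne G π hπ _ fun h => hLS ⟨hL, h⟩]
      simp
  have hmaps : ∀ L ∈ S,
      L.image π ∈ (Finset.univ : Finset (Finset U)).filter fun K => 2 ≤ K.card := by
    intro L hL
    simp only [S, Finset.mem_filter, Finset.mem_univ, true_and] at hL ⊢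
    exact hL.2 ▸ hL.1
  rw [hrestrict, ← Finset.sum_fiberwise_of_maps_to hmaps, lamP]
  refine Finset.sum_le_sum fun K _ => ?_
  calc ∑ L ∈ S.filter (fun L => L.image π = K), dMass G (pullback G π θ) L ^ 2 / p ^ L.card
      = (∑ L ∈ S.filter (fun L => L.image π = K), dMass G (pullback G π θ) L ^ 2) /
          p ^ K.card := by
        rw [Finset.sum_div]
        refine Finset.sum_congr rfl fun L hL => ?_
        simp only [S, Finset.mem_filter, Finset.mem_univ, true_and] at hL
        rw [← hL.1.2, hL.2]
    _ ≤ dMass (pushHG π G) θ K ^ 2 / p ^ K.card := by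
        refine div_le_div_of_nonneg_right ?_ (pow_nonneg hp.le _)
        refine (Finset.sum_sq_le_sq_sum_of_nonneg fun L _ => hd L).trans ?_
        exact pow_le_pow_left₀ (Finset.sum_nonneg fun L _ => hd L)
          (sum_dMass_pullback_le G π hπ hθ.1 K _ fun L hL => (Finset.mem_filter.mp hL).2) 2

end
end
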